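/- arXiv:1101.5632 — 2 statements merged into one kernel-verified Lean document; each statement's English description precedes it below -/
import Mathlib

section
/- Let i ≥ 1 be an integer and let x_0, x_1, …, x_{i+1} be pairwise distinct points of ℝ² such that x_j lies in column j (i.e., has first coordinate j·ω₁) for each j = 0, …, i+1, and assume the kernel matrix Σ_{x_{0:i} x_{0:i}} is positive definite. If ξ < ρ/i, then 0 ≤ σ²_{x_{i+1}|x_i} − σ²_{x_{i+1}|x_{0:i}} ≤ σ_s²·ξ⁴/(ρ/i − ξ), where x_{0:i} denotes the tuple (x_0, …, x_i). -/
open Real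

/-- Squared exponential covariance function on ℝ². -/
noncomputable def seCov (σs σn ℓ₁ ℓ₂ : ℝ) (u v : ℝ × ℝ) : ℝ :=
  σs ^ 2 * Real.exp (-((u.1 - v.1) ^ 2) / (2 * ℓ₁ ^ 2) - (u.2 - v.2) ^ 2 / (2 * ℓ₂ ^ 2)) +
    σn ^ 2 * (if u = v then 1 else 0)

/-- Kernel (covariance) matrix of a finite tuple of locations. -/
noncomputable def kerMat (σs σn ℓ₁ ℓ₂ : ℝ) {ι : Type} [Fintype ι]
    (x : ι → ℝ × ℝ) : Matrix ι ι ℝ :=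
  Matrix.of fun j k => seCov σs σn ℓ₁ ℓ₂ (x j) (x k)

/-- Posterior (conditional) variance σ²_{u|x} = σ(u,u) − Σ_{uX} Σ_{XX}⁻¹ Σ_{Xu}. -/
noncomputable def postVar (σs σn ℓ₁ ℓ₂ : ℝ) (u : ℝ × ℝ) {ι : Type} [Fintype ι] [DecidableEq ι]
    (x : ι → ℝ × ℝ) : ℝ :=
  seCov σs σn ℓ₁ ℓ₂ u u -
    ∑ j, ∑ k, seCov σs σn ℓ₁ ℓ₂ u (x j) * (kerMat σs σn ℓ₁ ℓ₂ x)⁻¹ j k *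
      seCov σs σn ℓ₁ ℓ₂ (x k) u

open Matrix

/-- Gershgorin-type lower bound: constant diagonal `D` and off-diagonal entries at most `e` in
absolute value. -/
theorem le_dotProduct_mulVec_of_abs_offDiag_le {ι : Type*} [Fintype ι] [DecidableEq ι]
    (M : Matrix ι ι ℝ) (D e : ℝ) (hD : ∀ j, M j j = D) (he : ∀ j k, j ≠ k → |M j k| ≤ e)
    (z : ι → ℝ) :
    (D - (Fintype.card ι - 1) * e) * (z ⬝ᵥ z) ≤ z ⬝ᵥ (M *ᵥ z) := by
  have hterm : ∀ j k, (if j = k then (D + e) * z j ^ 2 else 0) - e * (z j ^ 2 + z k ^ 2) / 2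
      ≤ z j * (M j k * z k) := by
    intro j k
    split_ifs with h
    · subst h
      rw [hD]
      nlinarith
    · obtain ⟨h1, h2⟩ := abs_le.mp (he j k h)
      nlinarith [mul_nonneg (sub_nonneg.mpr h2) (sq_nonneg (z j - z k)),
        mul_nonneg (neg_le_iff_add_nonneg.mp h1) (sq_nonneg (z j + z k))]
  calc (D - (Fintype.card ι - 1) * e) * (z ⬝ᵥ z)
      = ∑ j, ∑ k, ((if j = k then (D + e) * z j ^ 2 else 0) - e * (z j ^ 2 + z k ^ 2) / 2) := by
        simp only [Finset.sum_sub_distrib, Finset.sum_ite_eq, Finset.mem_univ, if_true,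
          ← Finset.sum_div, ← Finset.mul_sum, Finset.sum_add_distrib, Finset.sum_const,
          Finset.card_univ, nsmul_eq_mul, dotProduct, ← sq]
        ring
    _ ≤ ∑ j, ∑ k, z j * (M j k * z k) :=
        Finset.sum_le_sum fun j _ => Finset.sum_le_sum fun k _ => hterm j k
    _ = z ⬝ᵥ (M *ᵥ z) := by simp only [dotProduct, mulVec, Finset.mul_sum]

/-- If the quadratic form of `M` is bounded below by `lam`, that of `M⁻¹` is bounded above by
`lam⁻¹`. -/
theorem dotProduct_inv_mulVec_le {ι : Type*} [Fintype ι] [DecidableEq ι]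
    (M : Matrix ι ι ℝ) (hM : IsUnit M.det) {lam : ℝ} (hlam : 0 < lam)
    (h : ∀ z, lam * (z ⬝ᵥ z) ≤ z ⬝ᵥ (M *ᵥ z)) (r : ι → ℝ) :
    r ⬝ᵥ (M⁻¹ *ᵥ r) ≤ (r ⬝ᵥ r) / lam := by
  have hz := h (M⁻¹ *ᵥ r)
  rw [mulVec_mulVec, mul_nonsing_inv _ hM, one_mulVec, dotProduct_comm _ r] at hz
  have hsq : 0 ≤ (r - lam • (M⁻¹ *ᵥ r)) ⬝ᵥ (r - lam • (M⁻¹ *ᵥ r)) :=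
    Finset.sum_nonneg fun _ _ => mul_self_nonneg _
  simp only [sub_dotProduct, dotProduct_sub, smul_dotProduct, dotProduct_smul, smul_eq_mul,
    dotProduct_comm _ r] at hsq
  rw [le_div_iff₀ hlam]
  nlinarith

/-- Eliminating one coordinate from the quadratic form of `M⁻¹`. -/
theorem dotProduct_inv_mulVec_sub_sq_div {ι : Type*} [Fintype ι] [DecidableEq ι]
    (M : Matrix ι ι ℝ) (hM : IsUnit M.det) (hsymm : Mᵀ = M) (v : ι → ℝ) (b : ι)
    (hb : M b b ≠ 0) :
    v ⬝ᵥ (M⁻¹ *ᵥ v) - v b ^ 2 / M b b =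
      (v - (v b / M b b) • M.col b) ⬝ᵥ (M⁻¹ *ᵥ (v - (v b / M b b) • M.col b)) := by
  have hcol : M⁻¹ *ᵥ M.col b = Pi.single b 1 := by
    rw [← mulVec_single_one, mulVec_mulVec, nonsing_inv_mul _ hM, one_mulVec]
  have hrow : M.col b ⬝ᵥ (M⁻¹ *ᵥ v) = v b := by
    have hvec : M.col b ᵥ* M⁻¹ = M⁻¹ *ᵥ M.col b := by
      rw [← mulVec_transpose, transpose_nonsing_inv, hsymm]
    rw [dotProduct_mulVec, hvec, hcol, single_one_dotProduct]
  rw [mulVec_sub, mulVec_smul, hcol]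
  simp only [sub_dotProduct, dotProduct_sub, smul_dotProduct, dotProduct_smul, smul_eq_mul, hrow,
    dotProduct_single_one, Pi.sub_apply, Pi.smul_apply, col_apply]
  field_simp
  ring

theorem seCov_comm (σs σn ℓ₁ ℓ₂ : ℝ) (u v : ℝ × ℝ) :
    seCov σs σn ℓ₁ ℓ₂ u v = seCov σs σn ℓ₁ ℓ₂ v u := by
  simp only [seCov, sub_sq_comm u.1, sub_sq_comm u.2, eq_comm (a := u)]

theorem seCov_self (σs σn ℓ₁ ℓ₂ : ℝ) (u : ℝ × ℝ) :
    seCov σs σn ℓ₁ ℓ₂ u u = σs ^ 2 + σn ^ 2 := by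
  simp [seCov]

theorem seCov_nonneg (σs σn ℓ₁ ℓ₂ : ℝ) (u v : ℝ × ℝ) : 0 ≤ seCov σs σn ℓ₁ ℓ₂ u v := by
  unfold seCov
  split_ifs <;> positivity

theorem seCov_le_mul_pow (σs σn ℓ₁ ℓ₂ ω : ℝ) {u v : ℝ × ℝ} (huv : u ≠ v) (m : ℕ)
    (h : m * ω ^ 2 ≤ (u.1 - v.1) ^ 2) :
    seCov σs σn ℓ₁ ℓ₂ u v ≤ σs ^ 2 * Real.exp (-ω ^ 2 / (2 * ℓ₁ ^ 2)) ^ m := by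
  rw [seCov, if_neg huv, mul_zero, add_zero, ← Real.exp_nat_mul]
  gcongr
  have h1 : 0 ≤ (u.2 - v.2) ^ 2 / (2 * ℓ₂ ^ 2) := by positivity
  have h2 : m * ω ^ 2 / (2 * ℓ₁ ^ 2) ≤ (u.1 - v.1) ^ 2 / (2 * ℓ₁ ^ 2) := by gcongr
  have h3 : m * (-ω ^ 2 / (2 * ℓ₁ ^ 2)) = -(m * ω ^ 2 / (2 * ℓ₁ ^ 2)) := by ring
  rw [h3, neg_div]
  linarith

theorem postVar_eq_sub_dotProduct (σs σn ℓ₁ ℓ₂ : ℝ) (u : ℝ × ℝ) {ι : Type} [Fintype ι]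
    [DecidableEq ι] (x : ι → ℝ × ℝ) :
    postVar σs σn ℓ₁ ℓ₂ u x = seCov σs σn ℓ₁ ℓ₂ u u -
      (fun j => seCov σs σn ℓ₁ ℓ₂ u (x j)) ⬝ᵥ
        ((kerMat σs σn ℓ₁ ℓ₂ x)⁻¹ *ᵥ fun j => seCov σs σn ℓ₁ ℓ₂ u (x j)) := by
  simp only [postVar, dotProduct, mulVec, Finset.mul_sum, mul_assoc,
    seCov_comm σs σn ℓ₁ ℓ₂ _ u]

theorem postVar_singleton (σs σn ℓ₁ ℓ₂ : ℝ) (u v : ℝ × ℝ) :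
    postVar σs σn ℓ₁ ℓ₂ u (fun _ : Fin 1 => v) = seCov σs σn ℓ₁ ℓ₂ u u -
      seCov σs σn ℓ₁ ℓ₂ u v ^ 2 / seCov σs σn ℓ₁ ℓ₂ v v := by
  simp only [postVar, inv_subsingleton, kerMat, Finset.univ_unique, Finset.sum_singleton,
    diagonal_apply_eq, of_apply, Ring.inverse_eq_inv', seCov_comm σs σn ℓ₁ ℓ₂ v u]
  ring

theorem stmt_0 (σs σn ℓ₁ ℓ₂ ω₁ ω₂ ξ ρ : ℝ)
    (hσs : 0 < σs) (hσn : 0 < σn) (hℓ₁ : 0 < ℓ₁) (hℓ₂ : 0 < ℓ₂)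
    (hω₁ : 0 < ω₁) (hω₂ : 0 < ω₂)
    (hξ : ξ = Real.exp (-ω₁ ^ 2 / (2 * ℓ₁ ^ 2)))
    (hρ : ρ = 1 + σn ^ 2 / σs ^ 2)
    (i : ℕ) (hi : 1 ≤ i) (x : ℕ → ℝ × ℝ)
    (hdist : ∀ j ≤ i + 1, ∀ k ≤ i + 1, j ≠ k → x j ≠ x k)
    (hcol : ∀ j ≤ i + 1, (x j).1 = (j : ℝ) * ω₁)
    (hPD : (kerMat σs σn ℓ₁ ℓ₂ (fun j : Fin (i + 1) => x j)).PosDef)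
    (hξρ : ξ < ρ / i) :
    0 ≤ postVar σs σn ℓ₁ ℓ₂ (x (i + 1)) (fun _ : Fin 1 => x i) -
        postVar σs σn ℓ₁ ℓ₂ (x (i + 1)) (fun j : Fin (i + 1) => x j) ∧
    postVar σs σn ℓ₁ ℓ₂ (x (i + 1)) (fun _ : Fin 1 => x i) -
        postVar σs σn ℓ₁ ℓ₂ (x (i + 1)) (fun j : Fin (i + 1) => x j) ≤
      σs ^ 2 * ξ ^ 4 / (ρ / i - ξ) := by
  have hξ0 : 0 < ξ := hξ ▸ Real.exp_pos _
  have hi0 : (0 : ℝ) < i := by exact_mod_cast hi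
  have hσρ : σs ^ 2 * ρ = σs ^ 2 + σn ^ 2 := by
    rw [hρ]
    field_simp
  have hcov : ∀ m : ℕ, ∀ j ≤ i + 1, ∀ k ≤ i + 1, j + m ≤ k → 1 ≤ m →
      seCov σs σn ℓ₁ ℓ₂ (x k) (x j) ≤ σs ^ 2 * ξ ^ m := by
    intro m j hj k hk hjk hm
    rw [hξ]
    refine seCov_le_mul_pow _ _ _ _ _ (hdist k hk j hj (by omega)) m ?_
    rw [hcol k hk, hcol j hj, ← sub_mul, mul_pow]
    have h1 : (1 : ℝ) ≤ m := by exact_mod_cast hm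
    have h2 : (j : ℝ) + m ≤ k := by exact_mod_cast hjk
    gcongr
    nlinarith
  set M := kerMat σs σn ℓ₁ ℓ₂ (fun j : Fin (i + 1) => x j) with hMdef
  have hMapp : ∀ j k, M j k = seCov σs σn ℓ₁ ℓ₂ (x j) (x k) := fun _ _ => rfl
  have hdiag : ∀ j, M j j = σs ^ 2 * ρ := fun j => by rw [hMapp, seCov_self, hσρ]
  have hoff : ∀ j k, j ≠ k → |M j k| ≤ σs ^ 2 * ξ := by
    intro j k hjk
    rw [hMapp, abs_of_nonneg (seCov_nonneg ..)]
    rcases lt_or_gt_of_ne (Fin.val_ne_of_ne hjk) with h | h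
    · rw [seCov_comm]
      simpa using hcov 1 j (by omega) k (by omega) h le_rfl
    · simpa using hcov 1 k (by omega) j (by omega) h le_rfl
  have hunit : IsUnit M.det := hPD.det_pos.ne'.isUnit
  have hgap : 0 < ρ - i * ξ := by
    rw [lt_div_iff₀ hi0] at hξρ
    linarith
  have hlow : ∀ z, σs ^ 2 * (ρ - i * ξ) * (z ⬝ᵥ z) ≤ z ⬝ᵥ (M *ᵥ z) := by
    intro z
    refine le_of_eq_of_le ?_ (le_dotProduct_mulVec_of_abs_offDiag_le M _ _ hdiag hoff z)
    rw [Fintype.card_fin]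
    push_cast
    ring
  have hρ1 : 1 ≤ ρ := by
    rw [hρ]
    linarith [show 0 ≤ σn ^ 2 / σs ^ 2 by positivity]
  set v : Fin (i + 1) → ℝ := fun j => seCov σs σn ℓ₁ ℓ₂ (x (i + 1)) (x j) with hv
  set r := v - (v (Fin.last i) / M (Fin.last i) (Fin.last i)) • M.col (Fin.last i) with hr
  have hlast : M (Fin.last i) (Fin.last i) ≠ 0 := by
    rw [hdiag]
    positivity
  have hdiff : postVar σs σn ℓ₁ ℓ₂ (x (i + 1)) (fun _ : Fin 1 => x i) -
      postVar σs σn ℓ₁ ℓ₂ (x (i + 1)) (fun j : Fin (i + 1) => x j) = r ⬝ᵥ (M⁻¹ *ᵥ r) := by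
    rw [hr, ← dotProduct_inv_mulVec_sub_sq_div M hunit
      (by ext j k; exact seCov_comm ..) v (Fin.last i) hlast,
      postVar_singleton, postVar_eq_sub_dotProduct, ← hMdef, ← hv, hMapp]
    simp only [hv, Fin.val_last]
    ring
  have hrlast : r (Fin.last i) = 0 := by
    simp [hr, div_mul_cancel₀ _ hlast]
  have hrj : ∀ j : Fin i, r j.castSucc * r j.castSucc ≤ (σs ^ 2 * ξ ^ 2) ^ 2 := by
    intro j
    have hj := j.isLt
    have hval : r j.castSucc = seCov σs σn ℓ₁ ℓ₂ (x (i + 1)) (x j) -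
        seCov σs σn ℓ₁ ℓ₂ (x (i + 1)) (x i) * seCov σs σn ℓ₁ ℓ₂ (x i) (x j) / (σs ^ 2 * ρ) := by
      simp only [hr, hv, Pi.sub_apply, Pi.smul_apply, smul_eq_mul, col_apply, hdiag, Fin.val_last,
        Fin.val_castSucc, hMapp, seCov_comm σs σn ℓ₁ ℓ₂ (x j) (x i)]
      ring
    have ha := hcov 2 j (by omega) (i + 1) le_rfl (by omega) (by norm_num)
    have hb := hcov 1 i (by omega) (i + 1) le_rfl le_rfl le_rfl
    have hc := hcov 1 j (by omega) i (by omega) (by omega) le_rfl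
    rw [pow_one] at hb hc
    have ha0 := seCov_nonneg σs σn ℓ₁ ℓ₂ (x (i + 1)) (x j)
    have hb0 := seCov_nonneg σs σn ℓ₁ ℓ₂ (x (i + 1)) (x i)
    have hc0 := seCov_nonneg σs σn ℓ₁ ℓ₂ (x i) (x j)
    have hprod0 : 0 ≤ seCov σs σn ℓ₁ ℓ₂ (x (i + 1)) (x i) * seCov σs σn ℓ₁ ℓ₂ (x i) (x j) /
        (σs ^ 2 * ρ) := by positivity
    have hprod : seCov σs σn ℓ₁ ℓ₂ (x (i + 1)) (x i) * seCov σs σn ℓ₁ ℓ₂ (x i) (x j) /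
        (σs ^ 2 * ρ) ≤ σs ^ 2 * ξ ^ 2 := by
      rw [div_le_iff₀ (by positivity)]
      calc _ ≤ (σs ^ 2 * ξ) * (σs ^ 2 * ξ) := by gcongr
        _ = σs ^ 2 * ξ ^ 2 * (σs ^ 2 * 1) := by ring
        _ ≤ _ := by gcongr
    rw [← sq, hval]
    exact sq_le_sq' (by linarith) (by linarith)
  have hrr : r ⬝ᵥ r ≤ i * (σs ^ 2 * ξ ^ 2) ^ 2 := by
    rw [dotProduct, Fin.sum_univ_castSucc, hrlast, mul_zero, add_zero]
    exact (Finset.sum_le_sum fun j _ => hrj j).trans (by simp)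
  rw [hdiff]
  refine ⟨?_, ?_⟩
  · simpa using hPD.inv.posSemidef.dotProduct_mulVec_nonneg r
  · calc r ⬝ᵥ (M⁻¹ *ᵥ r) ≤ (r ⬝ᵥ r) / (σs ^ 2 * (ρ - i * ξ)) :=
        dotProduct_inv_mulVec_le M hunit (by positivity) hlow r
      _ ≤ i * (σs ^ 2 * ξ ^ 2) ^ 2 / (σs ^ 2 * (ρ - i * ξ)) := by gcongr
      _ = σs ^ 2 * ξ ^ 4 / (ρ / i - ξ) := by
        have : ρ / i - ξ = (ρ - i * ξ) / i := by field_simp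
        rw [this]
        field_simp
end

section
/- Let S be a type, A a nonempty finite type, τ : S → A → S a deterministic transition function, t ≥ 0 an integer, and for each i ∈ {0,…,t} let f_i be a real-valued reward function on pairs (history, action) where a history is a tuple (x_0,…,x_i) ∈ S^{i+1}, let g_i : S × A → ℝ, and let Δ_i ≥ 0, such that f_i((x_0,…,x_i), a) ≤ g_i(x_i, a) ≤ f_i((x_0,…,x_i), a) + Δ_i for all histories and actions. Define by backward recursion V*_t(h) = max_{a∈A} f_t(h,a), V*_i(h) = max_{a∈A} [ f_i(h,a) + V*_{i+1}(h appended with τ(x_i,a)) ] for i < t, and Ṽ_t(x) = max_{a∈A} g_t(x,a), Ṽ_i(x) = max_{a∈A} [ g_i(x,a) + Ṽ_{i+1}(τ(x,a)) ] for i < t. Then: (1) for every i and every history h = (x_0,…,x_i), V*_i(h) ≤ Ṽ_i(x_i) ≤ V*_i(h) + Σ_{s=i}^{t} Δ_s; and (2) for any family π̃_i : S → A attaining the maximum in the Ṽ-recursion at every state and stage, the f-value V^{π̃}_0((x_0)) of following π̃ (defined by V^{π̃}_t(h) = f_t(h, π̃_t(x_t)) and V^{π̃}_i(h) = f_i(h,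 π̃_i(x_i)) + V^{π̃}_{i+1}(h appended with τ(x_i, π̃_i(x_i)))) satisfies V*_0((x_0)) − V^{π̃}_0((x_0)) ≤ Σ_{s=0}^{t} Δ_s for every x_0 ∈ S. -/
theorem stmt_10 (S A : Type) [Fintype A] [Nonempty A]
    (τ : S → A → S) (t : ℕ)
    (f : (i : ℕ) → (Fin (i + 1) → S) → A → ℝ)
    (g : ℕ → S → A → ℝ) (Δ : ℕ → ℝ)
    (hΔ : ∀ i ≤ t, 0 ≤ Δ i)
    -- the sandwich f ≤ g ≤ f + Δ on stagewise rewards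
    (hfg : ∀ i ≤ t, ∀ (h : Fin (i + 1) → S) (a : A),
      f i h a ≤ g i (h (Fin.last i)) a ∧ g i (h (Fin.last i)) a ≤ f i h a + Δ i)
    -- non-Markovian optimal value functions
    (Vstar : (i : ℕ) → (Fin (i + 1) → S) → ℝ)
    (hVstarT : ∀ h : Fin (t + 1) → S, Vstar t h = ⨆ a : A, f t h a)
    (hVstarI : ∀ i < t, ∀ h : Fin (i + 1) → S,
      Vstar i h = ⨆ a : A, (f i h a + Vstar (i + 1) (Fin.snoc h (τ (h (Fin.last i)) a))))
    -- Markov value functions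
    (Vtil : ℕ → S → ℝ)
    (hVtilT : ∀ x : S, Vtil t x = ⨆ a : A, g t x a)
    (hVtilI : ∀ i < t, ∀ x : S, Vtil i x = ⨆ a : A, (g i x a + Vtil (i + 1) (τ x a)))
    -- a policy attaining the maximum in the Ṽ-recursion at every state and stage
    (pol : ℕ → S → A)
    (hpolT : ∀ x : S, g t x (pol t x) = Vtil t x)
    (hpolI : ∀ i < t, ∀ x : S, g i x (pol i x) + Vtil (i + 1) (τ x (pol i x)) = Vtil i x)
    -- the f-value of following the policy
    (Vpol : (i : ℕ) → (Fin (i + 1) → S) → ℝ)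
    (hVpolT : ∀ h : Fin (t + 1) → S, Vpol t h = f t h (pol t (h (Fin.last t))))
    (hVpolI : ∀ i < t, ∀ h : Fin (i + 1) → S,
      Vpol i h = f i h (pol i (h (Fin.last i))) +
        Vpol (i + 1) (Fin.snoc h (τ (h (Fin.last i)) (pol i (h (Fin.last i)))))) :
    (∀ i ≤ t, ∀ h : Fin (i + 1) → S,
      Vstar i h ≤ Vtil i (h (Fin.last i)) ∧
        Vtil i (h (Fin.last i)) ≤ Vstar i h + ∑ s ∈ Finset.Icc i t, Δ s) ∧
    (∀ x₀ : S,
      Vstar 0 (fun _ => x₀) - Vpol 0 (fun _ => x₀) ≤ ∑ s ∈ Finset.Icc 0 t, Δ s) := by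
  have bdd (u : A → ℝ) : BddAbove (Set.range u) := Set.finite_range u |>.bddAbove
  have key : ∀ i ≤ t, ∀ h : Fin (i + 1) → S,
      Vstar i h ≤ Vtil i (h (Fin.last i)) ∧ Vpol i h ≤ Vstar i h ∧
        Vtil i (h (Fin.last i)) ≤ Vpol i h + ∑ s ∈ Finset.Icc i t, Δ s := by
    intro i hi
    induction hi using Nat.decreasingInduction with
    | self =>
      intro h
      refine ⟨?_, ?_, ?_⟩
      · rw [hVstarT, hVtilT]
        exact ciSup_mono (bdd _) fun a => (hfg t le_rfl h a).1
      · rw [hVstarT, hVpolT]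
        exact le_ciSup (bdd _) _
      · rw [← hpolT, hVpolT, Finset.Icc_self, Finset.sum_singleton]
        exact (hfg t le_rfl h _).2
    | of_succ i hi ih =>
      intro h
      have step (a : A) := ih (Fin.snoc h (τ (h (Fin.last i)) a))
      simp only [Fin.snoc_last] at step
      refine ⟨?_, ?_, ?_⟩
      · rw [hVstarI i hi, hVtilI i hi]
        exact ciSup_mono (bdd _) fun a => add_le_add (hfg i hi.le h a).1 (step a).1
      · rw [hVstarI i hi, hVpolI i hi]
        exact le_ciSup_of_le (bdd _) (pol i (h (Fin.last i))) (by gcongr; exact (step _).2.1)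
      · rw [← hpolI i hi, hVpolI i hi, ← Finset.add_sum_Ioc_eq_sum_Icc hi.le,
          ← Finset.Icc_add_one_left_eq_Ioc]
        linarith [(hfg i hi.le h (pol i (h (Fin.last i)))).2, (step (pol i (h (Fin.last i)))).2.2]
  refine ⟨fun i hi h => ?_, fun x₀ => ?_⟩
  · obtain ⟨h₁, h₂, h₃⟩ := key i hi h
    exact ⟨h₁, by linarith⟩
  · obtain ⟨h₁, -, h₃⟩ := key 0 t.zero_le fun _ => x₀
    linarith
end
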